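/- In the slack-allocation game with the linear clearing rule and bounded actions C j ∈ [0, M], the maximal claim is a weakly dominant strategy: for every player j, every fixed nonnegative claims C_{−j} of the others, and every a ∈ [0, M], player j's payoff when claiming M is at least player j's payoff when claiming a. -/

import Mathlib

/-- Overage of player `j`: `v j = max (C j - L j) 0`. -/
noncomputable def overage {n : ℕ} (L C : Fin n → ℝ) (j : Fin n) : ℝ :=
  max (C j - L j) 0

/-- Slack of player `j`: `s j = max (L j - C j) 0`. -/
noncomputable def slack {n : ℕ} (L C : Fin n → ℝ) (j : Fin n) : ℝ :=
  max (L j - C j) 0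

/-- Aggregate overage `X = ∑ j, v j`. -/
noncomputable def totOverage {n : ℕ} (L C : Fin n → ℝ) : ℝ :=
  ∑ j, overage L C j

/-- Aggregate slack `I = ∑ j, s j`. -/
noncomputable def totSlack {n : ℕ} (L C : Fin n → ℝ) : ℝ :=
  ∑ j, slack L C j

/-- Covered overage under the linear clearing rule:
`v̂ j = v j` if `X ≤ I`, and `v̂ j = (I / X) * v j` if `X > I`. -/
noncomputable def covered {n : ℕ} (L C : Fin n → ℝ) (j : Fin n) : ℝ :=
  if totOverage L C ≤ totSlack L C then overage L C j
  else (totSlack L C / totOverage L C) * overage L C j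

/-- Payoff: `π j = C j` if `C j ≤ L j`, and `π j = L j + v̂ j` if `C j > L j`. -/
noncomputable def payoff {n : ℕ} (L C : Fin n → ℝ) (j : Fin n) : ℝ :=
  if C j ≤ L j then C j else L j + covered L C j

/-- The linear clearing rule for own overage `x`, others' overage `V` and aggregate slack `S` is
monotone in `x`. -/
theorem linear_clearing_mono {S V x y : ℝ} (hS : 0 ≤ S) (hV : 0 ≤ V) (hx : 0 < x) (hxy : x ≤ y) :
    (if x + V ≤ S then x else S / (x + V) * x) ≤
      (if y + V ≤ S then y else S / (y + V) * y) := by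
  have hxV : 0 < x + V := by linarith
  have hyV : 0 < y + V := by linarith
  split_ifs with h₁ h₂ h₂
  · exact hxy
  · rw [div_mul_eq_mul_div, le_div_iff₀ hyV]
    nlinarith [mul_nonneg hV (sub_nonneg.2 hxy),
      mul_nonneg (sub_nonneg.2 h₁) (hx.le.trans hxy)]
  · linarith
  · rw [div_mul_eq_mul_div, div_mul_eq_mul_div, div_le_div_iff₀ hxV hyV]
    nlinarith [mul_nonneg hS (mul_nonneg hV (sub_nonneg.2 hxy))]

theorem overage_nonneg {n : ℕ} (L C : Fin n → ℝ) (j : Fin n) : 0 ≤ overage L C j :=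
  le_max_right _ _

theorem totOverage_nonneg {n : ℕ} (L C : Fin n → ℝ) : 0 ≤ totOverage L C :=
  Finset.sum_nonneg fun i _ => overage_nonneg L C i

theorem totSlack_nonneg {n : ℕ} (L C : Fin n → ℝ) : 0 ≤ totSlack L C :=
  Finset.sum_nonneg fun _ _ => le_max_right _ _

theorem covered_nonneg {n : ℕ} (L C : Fin n → ℝ) (j : Fin n) : 0 ≤ covered L C j := by
  unfold covered
  split_ifs
  · exact overage_nonneg L C j
  · exact mul_nonneg (div_nonneg (totSlack_nonneg L C) (totOverage_nonneg L C))
      (overage_nonneg L C j)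

/-- The covered overage of a player claiming `x` above the entitlement, in terms of the others'
overage and slack. -/
theorem covered_update {n : ℕ} (L C : Fin n → ℝ) (j : Fin n) {x : ℝ} (hx : L j < x) :
    covered L (Function.update C j x) j =
      if x - L j + ∑ i ∈ Finset.univ.erase j, overage L C i ≤
          ∑ i ∈ Finset.univ.erase j, slack L C i
      then x - L j
      else (∑ i ∈ Finset.univ.erase j, slack L C i) /
        (x - L j + ∑ i ∈ Finset.univ.erase j, overage L C i) * (x - L j) := by
  have hv : overage L (Function.update C j x) j = x - L j := by
    simp [overage, hx.le]
  have hs : slack L (Function.update C j x) j = 0 := by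
    simp [slack, hx.le]
  have hX : totOverage L (Function.update C j x) =
      x - L j + ∑ i ∈ Finset.univ.erase j, overage L C i := by
    rw [totOverage, ← Finset.add_sum_erase _ _ (Finset.mem_univ j), hv]
    congr 1
    refine Finset.sum_congr rfl fun i hi => ?_
    simp [overage, Function.update_of_ne (Finset.ne_of_mem_erase hi)]
  have hI : totSlack L (Function.update C j x) = ∑ i ∈ Finset.univ.erase j, slack L C i := by
    rw [totSlack, ← Finset.add_sum_erase _ _ (Finset.mem_univ j), hs, zero_add]
    refine Finset.sum_congr rfl fun i hi => ?_
    simp [slack, Function.update_of_ne (Finset.ne_of_mem_erase hi)]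
  rw [covered, hX, hI, hv]

/-- With bounded actions `C j ∈ [0, M]`, the maximal claim `M` is weakly
dominant: for every `j`, every fixed nonnegative claims of the others, and
every `a ∈ [0, M]`, claiming `M` yields at least the payoff of claiming `a`. -/
theorem max_claim_weakly_dominant {n : ℕ} (M : ℝ) (hM : 0 < M)
    (L C : Fin n → ℝ) (hL : ∀ i, 0 < L i) (j : Fin n)
    (hC : ∀ i, i ≠ j → 0 ≤ C i) :
    ∀ a : ℝ, 0 ≤ a → a ≤ M →
      payoff L (Function.update C j a) j ≤ payoff L (Function.update C j M) j := by
  intro a _ haM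
  simp only [payoff, Function.update_self]
  split_ifs with ha hM' hM'
  · exact haM
  · linarith [covered_nonneg L (Function.update C j M) j]
  · linarith
  · rw [covered_update L C j (not_le.1 ha), covered_update L C j (not_le.1 hM')]
    gcongr
    exact linear_clearing_mono (Finset.sum_nonneg fun _ _ => le_max_right _ _)
      (Finset.sum_nonneg fun i _ => overage_nonneg L C i) (sub_pos.2 (not_le.1 ha))
      (sub_le_sub_right haM _)
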